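/- If A, B ∈ ℝ^{n×n} are premetrics, then (A ⊙ B)* = (B ⊙ A)* = (A ⊕ B)*. -/

import Mathlib

namespace TropComm

variable {n : ℕ}

/-- Tropical (min-plus) matrix product: `(A ⊙ B) i j = min_s (A i s + B s j)`. -/
def tropMul [NeZero n] (A B : Fin n → Fin n → ℝ) : Fin n → Fin n → ℝ :=
  fun i j => Finset.univ.inf' Finset.univ_nonempty (fun s => A i s + B s j)

/-- Tropical matrix-vector product: `(A ⊙ x) i = min_j (A i j + x j)`. -/
def tropMulVec [NeZero n] (A : Fin n → Fin n → ℝ) (x : Fin n → ℝ) : Fin n → ℝ :=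
  fun i => Finset.univ.inf' Finset.univ_nonempty (fun j => A i j + x j)

/-- Tropical sum: entrywise minimum. -/
def tropSum (A B : Fin n → Fin n → ℝ) : Fin n → Fin n → ℝ :=
  fun i j => min (A i j) (B i j)

/-- `tropPow A k` is the k-fold tropical product `A^{⊙k}` (with the junk value
`tropPow A 0 = A`; only exponents `k ≥ 1` are ever used). -/
def tropPow [NeZero n] (A : Fin n → Fin n → ℝ) : ℕ → (Fin n → Fin n → ℝ)
  | 0 => A
  | 1 => A
  | (k + 2) => tropMul A (tropPow A (k + 1))

/-- Kleene star `A* = A ⊕ A^{⊙2} ⊕ ⋯ ⊕ A^{⊙n}`. -/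
def kleene [NeZero n] (A : Fin n → Fin n → ℝ) : Fin n → Fin n → ℝ :=
  fun i j => Finset.univ.inf' Finset.univ_nonempty (fun k : Fin n => tropPow A (k.val + 1) i j)

/-- A premetric: zero diagonal, positive off-diagonal entries. -/
def IsPremetric (A : Fin n → Fin n → ℝ) : Prop :=
  (∀ i, A i i = 0) ∧ ∀ i j, i ≠ j → 0 < A i j

/-- A polytrope: a premetric satisfying the triangle inequality. -/
def IsPolytrope (A : Fin n → Fin n → ℝ) : Prop :=
  IsPremetric A ∧ ∀ i j k, A i j ≤ A i k + A k j


/-- The total `A`-weight of a walk in the complete graph. -/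
def walkWeight (A : Fin n → Fin n → ℝ) :
    {i j : Fin n} → (⊤ : SimpleGraph (Fin n)).Walk i j → ℝ
  | _, _, .nil => 0
  | _, _, .cons (u := u) (v := v) _ p => A u v + walkWeight A p

lemma walkWeight_append (A : Fin n → Fin n → ℝ) {i j k : Fin n}
    (p : (⊤ : SimpleGraph (Fin n)).Walk i j) (q : (⊤ : SimpleGraph (Fin n)).Walk j k) :
    walkWeight A (p.append q) = walkWeight A p + walkWeight A q := by
  induction p with
  | nil => simp [walkWeight]
  | cons h p ih => simp [walkWeight, ih, add_assoc]

lemma walkWeight_nonneg {A : Fin n → Fin n → ℝ} (hA : ∀ i j, 0 ≤ A i j) {i j : Fin n}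
    (p : (⊤ : SimpleGraph (Fin n)).Walk i j) : 0 ≤ walkWeight A p := by
  induction p with
  | nil => simp [walkWeight]
  | cons h p ih => exact add_nonneg (hA _ _) ih

lemma walkWeight_bypass_le {A : Fin n → Fin n → ℝ} (hA : ∀ i j, 0 ≤ A i j) {i j : Fin n}
    (p : (⊤ : SimpleGraph (Fin n)).Walk i j) : walkWeight A p.bypass ≤ walkWeight A p := by
  induction p with
  | nil => simp [SimpleGraph.Walk.bypass]
  | @cons u v w h p ih =>
    simp only [SimpleGraph.Walk.bypass]
    split_ifs with hs
    · have h1 := walkWeight_append A (p.bypass.takeUntil u hs) (p.bypass.dropUntil u hs)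
      rw [SimpleGraph.Walk.take_spec] at h1
      have h2 := walkWeight_nonneg hA (p.bypass.takeUntil u hs)
      have h3 := hA u v
      simp only [walkWeight]
      linarith
    · simp only [walkWeight]
      linarith

lemma tropMul_le [NeZero n] (A B : Fin n → Fin n → ℝ) (i s j : Fin n) :
    tropMul A B i j ≤ A i s + B s j :=
  Finset.inf'_le _ (Finset.mem_univ s)

lemma exists_tropMul_eq [NeZero n] (A B : Fin n → Fin n → ℝ) (i j : Fin n) :
    ∃ s, tropMul A B i j = A i s + B s j := by
  obtain ⟨s, -, hs⟩ := Finset.exists_mem_eq_inf' Finset.univ_nonempty (fun s => A i s + B s j)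
  exact ⟨s, hs⟩

lemma tropPow_self_le_zero [NeZero n] {A : Fin n → Fin n → ℝ} (hA : ∀ i, A i i = 0)
    (k : ℕ) (i : Fin n) : tropPow A (k + 1) i i ≤ 0 := by
  induction k with
  | zero => exact (hA i).le
  | succ k ih =>
    have := tropMul_le A (tropPow A (k + 1)) i i i
    rw [hA] at this
    exact this.trans (by linarith)

lemma tropPow_le_walkWeight [NeZero n] {A : Fin n → Fin n → ℝ} (hA : ∀ i, A i i = 0)
    {i j : Fin n} (p : (⊤ : SimpleGraph (Fin n)).Walk i j) {k : ℕ} (hk : p.length ≤ k) :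
    tropPow A (k + 1) i j ≤ walkWeight A p := by
  induction p generalizing k with
  | nil => exact tropPow_self_le_zero hA k _
  | @cons u v w h p ih =>
    rw [SimpleGraph.Walk.length_cons] at hk
    obtain ⟨k, rfl⟩ : ∃ m, k = m + 1 := ⟨k - 1, by omega⟩
    have h1 := tropMul_le A (tropPow A (k + 1)) u v w
    have h2 := ih (k := k) (by omega)
    exact h1.trans (by simp only [walkWeight]; linarith)

lemma exists_cons_walkWeight_eq {A : Fin n → Fin n → ℝ} (hA : ∀ i, A i i = 0) (i : Fin n)
    {s j : Fin n} (p : (⊤ : SimpleGraph (Fin n)).Walk s j) :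
    ∃ q : (⊤ : SimpleGraph (Fin n)).Walk i j, walkWeight A q = A i s + walkWeight A p := by
  by_cases h : i = s
  · subst h
    exact ⟨p, by simp [hA]⟩
  · exact ⟨.cons h p, rfl⟩

lemma exists_walkWeight_eq_tropPow [NeZero n] {A : Fin n → Fin n → ℝ} (hA : ∀ i, A i i = 0)
    (k : ℕ) (i j : Fin n) :
    ∃ p : (⊤ : SimpleGraph (Fin n)).Walk i j, walkWeight A p = tropPow A (k + 1) i j := by
  induction k generalizing i with
  | zero => simpa [walkWeight, tropPow] using exists_cons_walkWeight_eq hA i (.nil : (⊤ : SimpleGraph (Fin n)).Walk j j)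
  | succ k ih =>
    obtain ⟨s, hs⟩ := exists_tropMul_eq A (tropPow A (k + 1)) i j
    obtain ⟨p, hp⟩ := ih s
    obtain ⟨q, hq⟩ := exists_cons_walkWeight_eq hA i p
    exact ⟨q, by rw [hq, hp]; exact hs.symm⟩

lemma kleene_le_walkWeight [NeZero n] {A : Fin n → Fin n → ℝ} (hA : ∀ i, A i i = 0)
    (hA' : ∀ i j, 0 ≤ A i j) {i j : Fin n} (p : (⊤ : SimpleGraph (Fin n)).Walk i j) :
    kleene A i j ≤ walkWeight A p := by
  have hlen : p.bypass.length < n := by simpa using p.bypass_isPath.length_lt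
  exact (Finset.inf'_le _ (Finset.mem_univ (⟨p.bypass.length, hlen⟩ : Fin n))).trans
    ((tropPow_le_walkWeight hA p.bypass le_rfl).trans (walkWeight_bypass_le hA' p))

lemma exists_walkWeight_eq_kleene [NeZero n] {A : Fin n → Fin n → ℝ} (hA : ∀ i, A i i = 0)
    (i j : Fin n) :
    ∃ p : (⊤ : SimpleGraph (Fin n)).Walk i j, walkWeight A p = kleene A i j := by
  obtain ⟨k, -, hk⟩ := Finset.exists_mem_eq_inf' Finset.univ_nonempty
    (fun k : Fin n => tropPow A (k.val + 1) i j)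
  obtain ⟨p, hp⟩ := exists_walkWeight_eq_tropPow hA k i j
  exact ⟨p, hp.trans hk.symm⟩

lemma kleene_triangle [NeZero n] {A : Fin n → Fin n → ℝ} (hA : ∀ i, A i i = 0)
    (hA' : ∀ i j, 0 ≤ A i j) (i s j : Fin n) :
    kleene A i j ≤ kleene A i s + kleene A s j := by
  obtain ⟨p, hp⟩ := exists_walkWeight_eq_kleene hA i s
  obtain ⟨q, hq⟩ := exists_walkWeight_eq_kleene hA s j
  rw [← hp, ← hq, ← walkWeight_append]
  exact kleene_le_walkWeight hA hA' _

lemma kleene_le [NeZero n] (A : Fin n → Fin n → ℝ) (i j : Fin n) : kleene A i j ≤ A i j :=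
  Finset.inf'_le (fun k : Fin n => tropPow A (k.val + 1) i j) (Finset.mem_univ 0)

/-- The Kleene star of `A` dominates every matrix below `A` satisfying the triangle inequality. -/
lemma le_kleene [NeZero n] {A D : Fin n → Fin n → ℝ} (hD : ∀ i s j, D i j ≤ D i s + D s j)
    (hDA : ∀ i j, D i j ≤ A i j) (i j : Fin n) : D i j ≤ kleene A i j := by
  have key (k : ℕ) (i j : Fin n) : D i j ≤ tropPow A (k + 1) i j := by
    induction k generalizing i with
    | zero => exact hDA i j
    | succ k ih =>
      exact Finset.le_inf' Finset.univ_nonempty _ fun s _ => (hD i s j).trans (add_le_add (hDA i s) (ih s))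
  exact Finset.le_inf' _ _ fun k _ => key k i j

lemma IsPremetric.nonneg {A : Fin n → Fin n → ℝ} (hA : IsPremetric A) (i j : Fin n) :
    0 ≤ A i j := by
  by_cases h : i = j
  · exact h ▸ (hA.1 i).ge
  · exact (hA.2 i j h).le

lemma kleene_tropMul [NeZero n] {A B : Fin n → Fin n → ℝ} (hA : IsPremetric A)
    (hB : IsPremetric B) : kleene (tropMul A B) = kleene (tropSum A B) := by
  have mul_nonneg (i j : Fin n) : 0 ≤ tropMul A B i j :=
    Finset.le_inf' _ _ fun s _ => add_nonneg (hA.nonneg i s) (hB.nonneg s j)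
  have mul_le_left (i j : Fin n) : tropMul A B i j ≤ A i j := by
    simpa [hB.1] using tropMul_le A B i j j
  have mul_le_right (i j : Fin n) : tropMul A B i j ≤ B i j := by
    simpa [hA.1] using tropMul_le A B i i j
  have mul_self (i : Fin n) : tropMul A B i i = 0 :=
    le_antisymm ((mul_le_left i i).trans (hA.1 i).le) (mul_nonneg i i)
  have sum_triangle := kleene_triangle (A := tropSum A B) (fun i => by simp [tropSum, hA.1, hB.1])
    (fun i j => le_min (hA.nonneg i j) (hB.nonneg i j))
  funext i j
  apply le_antisymm
  · exact le_kleene (kleene_triangle mul_self mul_nonneg)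
      (fun i j => (kleene_le _ i j).trans (le_min (mul_le_left i j) (mul_le_right i j))) i j
  · refine le_kleene sum_triangle (fun i j => Finset.le_inf' _ _ fun s _ => ?_) i j
    exact (sum_triangle i s j).trans (add_le_add ((kleene_le _ i s).trans (min_le_left _ _))
      ((kleene_le _ s j).trans (min_le_right _ _)))

lemma tropSum_comm (A B : Fin n → Fin n → ℝ) : tropSum A B = tropSum B A := by
  funext i j
  exact min_comm _ _

/-- If `A, B` are premetrics, then `(A ⊙ B)* = (B ⊙ A)* = (A ⊕ B)*`. -/
theorem stmt10 {n : ℕ} [NeZero n] (A B : Fin n → Fin n → ℝ)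
    (hA : IsPremetric A) (hB : IsPremetric B) :
    kleene (tropMul A B) = kleene (tropMul B A) ∧
    kleene (tropMul B A) = kleene (tropSum A B) := by
  have hBA : kleene (tropMul B A) = kleene (tropSum A B) := by
    rw [kleene_tropMul hB hA, tropSum_comm]
  exact ⟨(kleene_tropMul hA hB).trans hBA.symm, hBA⟩

end TropComm
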